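/- (No free lunch theorem via description complexity, prefix-free form) Let n ≥ 1 and C ≥ 2 be natural numbers, let D be a prefix-free set of bitstrings, let d assign to each s ∈ D a classifier d(s) on an n-point dataset with C classes, let δ ∈ (0, 1], and let y : Fin n → Fin C be drawn from the uniform distribution on labelings. Then with probability at least 1 − δ, simultaneously for every s ∈ D, CE(d(s), y) ≥ ln C − (ln 2 / n) · (s.length + log₂(1/δ)). -/

import Mathlib

/-- A set of bitstrings is prefix-free if no element is a proper prefix of a different
element, i.e. any prefix relation within the set forces equality. -/
def PrefixFree (S : Set (List Bool)) : Prop :=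
  ∀ s ∈ S, ∀ t ∈ S, s <+: t → s = t

/-- A prefix-free code without the empty word is uniquely decodable. -/
theorem PrefixFree.uniquelyDecodable {S : Set (List Bool)} (hS : PrefixFree S)
    (hnil : [] ∉ S) : InformationTheory.UniquelyDecodable S := by
  intro L₁
  induction L₁ with
  | nil =>
    intro L₂ _ h₂ h
    cases L₂ with
    | nil => rfl
    | cons b L₂ =>
      have hb : b = [] := by simp at h; exact h.1
      exact absurd (hb ▸ h₂ b (by simp)) hnil
  | cons a L₁ ih =>
    intro L₂ h₁ h₂ h
    have ha : a ∈ S := h₁ a (by simp)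
    cases L₂ with
    | nil =>
      have ha' : a = [] := by simp at h; exact h.1
      exact absurd (ha' ▸ ha) hnil
    | cons b L₂ =>
      have hb : b ∈ S := h₂ b (by simp)
      simp only [List.flatten_cons] at h
      have hab : a = b := by
        rcases List.prefix_or_prefix_of_prefix (List.prefix_append a L₁.flatten)
          (h ▸ List.prefix_append b L₂.flatten) with hp | hp
        · exact hS a ha b hb hp
        · exact (hS b hb a ha hp).symm
      subst hab
      rw [ih L₂ (fun w hw => h₁ w (by simp [hw])) (fun w hw => h₂ w (by simp [hw]))
        (List.append_cancel_left h)]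

/-- **Kraft's inequality** for finite prefix-free sets of bitstrings. -/
theorem PrefixFree.kraft_inequality {S : Finset (List Bool)}
    (hS : PrefixFree (S : Set (List Bool))) : ∑ w ∈ S, (1 / 2 : ℝ) ^ w.length ≤ 1 := by
  by_cases hnil : [] ∈ S
  · have hsub : S = {[]} := by
      refine Finset.eq_singleton_iff_unique_mem.2 ⟨hnil, fun w hw => ?_⟩
      exact (hS [] hnil w hw List.nil_prefix).symm
    simp [hsub]
  · simpa using InformationTheory.kraft_mcmillan_inequality
      (hS.uniquelyDecodable (by simpa using hnil))

/-- The probabilities that a classifier assigns to all labelings add up to one. -/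
theorem sum_prod_eq_one_of_sum_eq_one {n C : ℕ} {p : Fin n → Fin C → ℝ}
    (hp : ∀ i, ∑ c, p i c = 1) : ∑ y : Fin n → Fin C, ∏ i, p i (y i) = 1 := by
  rw [← Fintype.piFinset_univ, ← Finset.prod_univ_sum]
  simp [hp]

/-- A labeling on which the empirical cross entropy is smaller than
`ln C - (ln 2 / n)·(L + log₂(1/δ))` has likelihood more than `2 ^ L / (δ * C ^ n)`. -/
theorem one_lt_mul_prod_of_crossEntropy_lt {n C L : ℕ} (hn : 1 ≤ n) (hC : 1 ≤ C)
    {q : Fin n → ℝ} (hq : ∀ i, 0 < q i) {δ : ℝ} (hδ : 0 < δ)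
    (h : -(1 / (n : ℝ)) * ∑ i, Real.log (q i) <
      Real.log C - (Real.log 2 / (n : ℝ)) * ((L : ℝ) + Real.logb 2 (1 / δ))) :
    1 < δ * (C : ℝ) ^ n * ((1 / 2 : ℝ) ^ L * ∏ i, q i) := by
  have hn' : (0 : ℝ) < n := by exact_mod_cast hn
  have hC' : (0 : ℝ) < C := by exact_mod_cast hC
  have hprod : 0 < ∏ i, q i := Finset.prod_pos fun i _ => hq i
  have hlog2 : Real.log 2 ≠ 0 := (Real.log_pos one_lt_two).ne'
  rw [← Real.log_pos_iff (by positivity), Real.log_mul (by positivity) (by positivity),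
    Real.log_mul (by positivity) (by positivity), Real.log_mul (by positivity) (by positivity),
    Real.log_pow, Real.log_pow, Real.log_prod (fun i _ => (hq i).ne'), one_div, Real.log_inv]
  have h' := mul_lt_mul_of_pos_left h hn'
  rw [Real.logb, one_div δ, Real.log_inv] at h'
  field_simp at h'
  linarith

/-- No free lunch via description complexity (prefix-free form): for a prefix-free set `D`
of descriptions, each `s ∈ D` describing a classifier `d s`, with probability at least
`1 - δ` over uniformly random labelings `y`, simultaneously for every `s ∈ D` the
empirical cross entropy `CE(d s, y) = -(1/n) ∑ᵢ log (d s i (y i))` (equal to `∞` if some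
`d s i (y i) = 0`, in which case the bound is trivial) is at least
`ln C - (ln 2 / n)·(|s| + log₂(1/δ))`. -/
theorem stmt_11 (n C : ℕ) (hn : 1 ≤ n) (hC : 2 ≤ C)
    (D : Set (List Bool)) (hD : PrefixFree D)
    (d : List Bool → Fin n → Fin C → ℝ)
    (hnn : ∀ s ∈ D, ∀ i c, 0 ≤ d s i c) (hsum : ∀ s ∈ D, ∀ i, ∑ c, d s i c = 1)
    (δ : ℝ) (hδ0 : 0 < δ) (hδ1 : δ ≤ 1) :
    1 - δ ≤ (Nat.card {y : Fin n → Fin C // ∀ s ∈ D,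
        (∀ i, d s i (y i) ≠ 0) →
        Real.log C - (Real.log 2 / (n : ℝ)) * ((s.length : ℝ) + Real.logb 2 (1 / δ))
          ≤ -(1 / (n : ℝ)) * ∑ i, Real.log (d s i (y i))} : ℝ) / (C : ℝ) ^ n := by
  classical
  have hC' : (0 : ℝ) < (C : ℝ) ^ n := by
    have : (0 : ℝ) < C := by exact_mod_cast (by omega : 0 < C)
    positivity
  rw [Nat.card_eq_fintype_card, Fintype.card_subtype, le_div_iff₀ hC']
  set good : (Fin n → Fin C) → Prop := fun y => ∀ s ∈ D, (∀ i, d s i (y i) ≠ 0) →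
    Real.log C - (Real.log 2 / (n : ℝ)) * ((s.length : ℝ) + Real.logb 2 (1 / δ))
      ≤ -(1 / (n : ℝ)) * ∑ i, Real.log (d s i (y i)) with hgood
  set B : Finset (Fin n → Fin C) := Finset.univ.filter fun y => ¬ good y with hB
  have hcard : ((Finset.univ.filter good).card : ℝ) + B.card = (C : ℝ) ^ n := by
    have := Finset.card_filter_add_card_filter_not (s := Finset.univ) good
    rw [Finset.card_univ, Fintype.card_fun, Fintype.card_fin, Fintype.card_fin] at this
    exact_mod_cast this
  let w : List Bool → (Fin n → Fin C) → ℝ := fun s y =>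
    δ * (C : ℝ) ^ n * ((1 / 2 : ℝ) ^ s.length * ∏ i, d s i (y i))
  have hw : ∀ s ∈ D, ∀ y, 0 ≤ w s y := fun s hs y =>
    mul_nonneg (by positivity)
      (mul_nonneg (by positivity) (Finset.prod_nonneg fun i _ => hnn s hs i _))
  have hbad : ∀ y, ∃ s, y ∈ B → s ∈ D ∧ 1 < w s y := by
    intro y
    by_cases hy : good y
    · exact ⟨[], fun h => absurd hy (Finset.mem_filter.1 h).2⟩
    · have hy' := hy
      simp only [hgood] at hy'
      push Not at hy'
      obtain ⟨s, hs, hne, hlt⟩ := hy'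
      exact ⟨s, fun _ => ⟨hs, one_lt_mul_prod_of_crossEntropy_lt hn (by omega)
        (fun i => (hnn s hs i _).lt_of_ne' (hne i)) hδ0 hlt⟩⟩
  choose f hf using hbad
  have hT : ∀ s ∈ B.image f, s ∈ D := by
    intro s hs
    obtain ⟨y, hy, rfl⟩ := Finset.mem_image.1 hs
    exact (hf y hy).1
  have hBcard : (B.card : ℝ) ≤ δ * (C : ℝ) ^ n := by
    calc (B.card : ℝ) = ∑ y ∈ B, 1 := by simp
      _ ≤ ∑ y ∈ B, ∑ s ∈ B.image f, w s y := Finset.sum_le_sum fun y hy =>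
          (hf y hy).2.le.trans (Finset.single_le_sum (f := fun s => w s y)
            (fun s hs => hw s (hT s hs) y) (Finset.mem_image_of_mem f hy))
      _ ≤ ∑ y, ∑ s ∈ B.image f, w s y :=
          Finset.sum_le_sum_of_subset_of_nonneg (Finset.subset_univ _)
            fun y _ _ => Finset.sum_nonneg fun s hs => hw s (hT s hs) y
      _ = ∑ s ∈ B.image f, δ * (C : ℝ) ^ n * (1 / 2 : ℝ) ^ s.length := by
          rw [Finset.sum_comm]
          refine Finset.sum_congr rfl fun s hs => ?_
          simp only [w, ← Finset.mul_sum]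
          rw [sum_prod_eq_one_of_sum_eq_one (hsum s (hT s hs)), mul_one]
      _ ≤ δ * (C : ℝ) ^ n := by
          rw [← Finset.mul_sum]
          exact mul_le_of_le_one_right (by positivity) (PrefixFree.kraft_inequality
            fun s hs t ht => hD s (hT s hs) t (hT t ht))
  linarith
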